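/- Let L : ℝ^p → (0,∞) be log-concave, β₀ ∈ ℝ^p, and C a bounded convex neighborhood of β₀ with boundary ∂C ⊂ {β₀ + ray directions}. Then ∫_{Cᶜ} L(β) dβ / ∫_C L(β) dβ ≤ sup_{v ∈ ∂C} [∫_1^∞ L(β₀ + (v−β₀)t) t^{p−1} dt] / [∫_0^1 L(β₀ + (v−β₀)t) t^{p−1} dt], where the integrals on the right are along rays from β₀ through boundary points v, using the polar (radial) decomposition of Lebesgue measure centered at β₀. -/

import Mathlib

open MeasureTheory Set

open Metric in
lemma polar_lintegral {p : ℕ} (hp : 0 < p) (F : (Fin p → ℝ) → ENNReal) (hF : Measurable F) :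
    ∫⁻ x, F x = ∫⁻ w : sphere (0 : Fin p → ℝ) 1, ∫⁻ r in Ioi (0:ℝ),
      ENNReal.ofReal (r ^ (p - 1)) * F (r • (w : Fin p → ℝ))
      ∂(volume : Measure ℝ) ∂((volume : Measure (Fin p → ℝ)).toSphere) := by
  have : Nonempty (Fin p) := ⟨⟨0, hp⟩⟩
  have hmp := (volume : Measure (Fin p → ℝ)).measurePreserving_homeomorphUnitSphereProd
  have hm2 : Measurable fun z : sphere (0 : Fin p → ℝ) 1 × Ioi (0:ℝ) =>
      F ((z.2 : ℝ) • (z.1 : Fin p → ℝ)) := by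
    apply hF.comp
    fun_prop
  calc ∫⁻ x, F x = ∫⁻ x : ({0}ᶜ : Set (Fin p → ℝ)), F x ∂((volume : Measure (Fin p → ℝ)).comap (Subtype.val)) := by
        rw [lintegral_subtype_comap (measurableSet_singleton _).compl F, restrict_compl_singleton]
    _ = ∫⁻ z, F ((z.2 : ℝ) • (z.1 : Fin p → ℝ))
          ∂((volume : Measure (Fin p → ℝ)).toSphere.prod (.volumeIoiPow (p - 1))) := by
        have h := hmp.lintegral_comp_emb (Homeomorph.measurableEmbedding _)
          (fun z => F ((z.2 : ℝ) • (z.1 : Fin p → ℝ)))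
        rw [Module.finrank_fin_fun] at h
        rw [← h]
        refine lintegral_congr fun x => ?_
        congr 1
        have hx : ‖(x : Fin p → ℝ)‖ ≠ 0 := norm_ne_zero_iff.2 x.2
        simp [smul_smul, hx]
    _ = _ := by
        rw [lintegral_prod _ hm2.aemeasurable]
        refine lintegral_congr fun w => ?_
        have hm3 : Measurable fun r : Ioi (0:ℝ) => F ((r : ℝ) • (w : Fin p → ℝ)) :=
          hm2.comp measurable_prodMk_left
        rw [Measure.volumeIoiPow, lintegral_withDensity_eq_lintegral_mul _ (by fun_prop) hm3]
        exact lintegral_subtype_comap measurableSet_Ioi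
          (fun r : ℝ => ENNReal.ofReal (r ^ (p - 1)) * F (r • (w : Fin p → ℝ)))

lemma logconc_cont {p : ℕ} (g : (Fin p → ℝ) → ℝ) (hpos : ∀ x, 0 < g x)
    (hc : ConcaveOn ℝ univ (fun x => Real.log (g x))) : Continuous g := by
  have h := continuousOn_univ.1 (hc.continuousOn isOpen_univ)
  have := Real.continuous_exp.comp h
  refine this.congr fun x => ?_
  simp [Real.exp_log (hpos x)]

open Metric Filter Topology in
lemma logconc_decay {p : ℕ} (g : (Fin p → ℝ) → ℝ) (hpos : ∀ x, 0 < g x)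
    (hc : ConcaveOn ℝ univ (fun x => Real.log (g x))) (hint : Integrable g) :
    ∃ A c : ℝ, 0 < A ∧ 0 < c ∧ ∀ x, g x ≤ A * Real.exp (-c * ‖x‖) := by
  have hg := logconc_cont g hpos hc
  set f := fun x => Real.log (g x) with hf
  have hfc : Continuous f := continuousOn_univ.1 (hc.continuousOn isOpen_univ)
  have hgf : ∀ x, g x = Real.exp (f x) := fun x => (Real.exp_log (hpos x)).symm
  set K := {x | f 0 - 1 ≤ f x} with hK
  have hKc : Convex ℝ K := by
    have := hc.convex_ge (f 0 - 1)
    simpa only [mem_univ, true_and] using this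
  have hKcl : IsClosed K := isClosed_le continuous_const hfc
  have hKfin : volume K < ⊤ := by
    refine lt_of_le_of_lt (measure_mono ?_) (hint.measure_norm_ge_lt_top (Real.exp_pos (f 0 - 1)))
    intro x hx
    have : Real.exp (f 0 - 1) ≤ g x := by
      rw [hgf]; exact Real.exp_le_exp.2 hx
    exact this.trans (le_abs_self _)
  have hK0 : K ∈ 𝓝 (0 : Fin p → ℝ) := by
    have := hfc.continuousAt (x := 0) |>.eventually (lt_mem_nhds (sub_one_lt (f 0)))
    filter_upwards [this] with x hx using le_of_lt hx
  obtain ⟨r, hr, hrK⟩ := Metric.mem_nhds_iff.1 hK0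
  obtain ⟨n, hn⟩ : ∃ n : ℕ, volume (K \ closedBall 0 (n:ℝ)) < volume (ball (0 : Fin p → ℝ) (r/2)) := by
    have ht : Tendsto (fun n : ℕ => volume (K \ closedBall (0 : Fin p → ℝ) (n:ℝ))) atTop
        (𝓝 (volume (⋂ n : ℕ, K \ closedBall (0 : Fin p → ℝ) (n:ℝ)))) := by
      apply tendsto_measure_iInter_atTop
      · intro n
        exact (hKcl.measurableSet.diff isClosed_closedBall.measurableSet).nullMeasurableSet
      · intro m n hmn
        exact sdiff_subset_sdiff_right (closedBall_subset_closedBall (by exact_mod_cast hmn))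
      · exact ⟨0, ((measure_mono sdiff_subset).trans_lt hKfin).ne⟩
    have he : (⋂ n : ℕ, K \ closedBall (0 : Fin p → ℝ) (n:ℝ)) = ∅ := by
      ext x
      simp only [mem_iInter, mem_empty_iff_false, iff_false, not_forall]
      obtain ⟨n, hn⟩ := exists_nat_ge ‖x‖
      exact ⟨n, fun h => h.2 (by simpa using hn)⟩
    rw [he, measure_empty] at ht
    exact (ht.eventually (gt_mem_nhds (measure_ball_pos _ _ (by positivity)))).exists
  set R : ℝ := 2 * n + r with hR
  have hRpos : 0 < R := by positivity
  have hout : ∀ x, R ≤ ‖x‖ → f x < f 0 - 1 := by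
    intro x hx
    by_contra hcon
    have hxK : x ∈ K := not_lt.1 hcon
    have hsub : ball ((1/2:ℝ) • x) (r/2) ⊆ K \ closedBall 0 (n:ℝ) := by
      intro y hy
      have hy' : ‖y - (1/2:ℝ) • x‖ < r / 2 := by simpa [dist_eq_norm] using hy
      constructor
      · have h2 : (2:ℝ) • (y - (1/2:ℝ) • x) ∈ K := by
          apply hrK
          simp only [mem_ball, dist_zero_right, norm_smul]
          norm_num
          norm_num at hy'
          linarith
        have := hKc hxK h2 (by norm_num : (0:ℝ) ≤ 1/2) (by norm_num : (0:ℝ) ≤ 1/2) (by norm_num)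
        convert! this using 1
        simp [smul_smul]
      · have : ‖(1/2:ℝ) • x‖ ≤ ‖y‖ + ‖y - (1/2:ℝ) • x‖ := by
          rw [norm_sub_rev]; exact norm_le_norm_add_norm_sub' _ _
        rw [norm_smul] at this
        norm_num at this hy'
        simp only [mem_closedBall, dist_zero_right, not_le]
        linarith
    have := measure_mono (μ := volume) hsub
    rw [Measure.addHaar_ball_center] at this
    exact absurd hn (not_lt.2 this)
  obtain ⟨M, hM⟩ := (isCompact_closedBall (0 : Fin p → ℝ) R).exists_bound_of_continuousOn hg.continuousOn
  have hfar : ∀ x, R ≤ ‖x‖ → g x ≤ g 0 * Real.exp (-(1/R) * ‖x‖) := by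
    intro x hx
    have hxp : 0 < ‖x‖ := hRpos.trans_le hx
    have h1 := hout ((R / ‖x‖) • x) (by
      rw [norm_smul, Real.norm_of_nonneg (by positivity), div_mul_cancel₀ _ hxp.ne'])
    have hq : R / ‖x‖ ≤ 1 := (div_le_one hxp).2 hx
    have h2 := hc.2 (mem_univ x) (mem_univ (0 : Fin p → ℝ)) (by positivity : 0 ≤ R / ‖x‖)
      (by linarith : 0 ≤ 1 - R / ‖x‖) (by ring)
    simp only [smul_zero, add_zero, smul_eq_mul] at h2
    change R / ‖x‖ * f x + (1 - R / ‖x‖) * f 0 ≤ f _ at h2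
    have h3 : R / ‖x‖ * (f x - f 0) < -1 := by linarith
    have h4 : f x - f 0 < -(1/R) * ‖x‖ := by
      have h5 : 0 < ‖x‖ / R := by positivity
      have := mul_lt_mul_of_pos_left h3 h5
      have e : ‖x‖ / R * (R / ‖x‖ * (f x - f 0)) = f x - f 0 := by field_simp
      rw [e] at this
      calc f x - f 0 < _ := this
        _ = _ := by ring
    rw [hgf x, hgf 0, ← Real.exp_add]
    exact Real.exp_le_exp.2 (by linarith)
  refine ⟨|M| * Real.exp 1 + g 0, 1 / R, by have := hpos 0; positivity, by positivity, fun x => ?_⟩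
  rcases le_total R ‖x‖ with hx | hx
  · refine (hfar x hx).trans ?_
    gcongr
    have : 0 ≤ |M| * Real.exp 1 := by positivity
    linarith
  · have h1 : g x ≤ |M| := (le_abs_self _).trans ((hM x (by simpa using hx)).trans (le_abs_self _))
    have h2 : 1 ≤ Real.exp 1 * Real.exp (-(1/R) * ‖x‖) := by
      rw [← Real.exp_add, Real.one_le_exp_iff]
      have : ‖x‖ / R ≤ 1 := (div_le_one hRpos).2 hx
      have e : -(1/R) * ‖x‖ = -(‖x‖ / R) := by ring
      linarith
    calc g x ≤ |M| * 1 := by linarith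
      _ ≤ |M| * (Real.exp 1 * Real.exp (-(1/R) * ‖x‖)) := by gcongr
      _ ≤ _ := by
        have : 0 ≤ g 0 * Real.exp (-(1/R) * ‖x‖) := by have := hpos 0; positivity
        linarith

lemma exp_moment (n : ℕ) {b : ℝ} (hb : 0 < b) :
    IntegrableOn (fun t : ℝ => Real.exp (-b * t) * t ^ n) (Ioi 0) := by
  have h := integrableOn_rpow_mul_exp_neg_mul_rpow (p := 1) (s := (n:ℝ)) (b := b)
    (by have : (0:ℝ) ≤ n := n.cast_nonneg
        linarith) one_pos hb
  refine h.congr_fun (fun t ht => ?_) measurableSet_Ioi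
  simp only [Real.rpow_natCast, Real.rpow_one]
  ring

lemma ray_integrable {p : ℕ} (n : ℕ) (g : (Fin p → ℝ) → ℝ) (hpos : ∀ x, 0 < g x)
    (hg : Continuous g) {A c : ℝ} (hA : 0 < A) (hc : 0 < c)
    (hd : ∀ x, g x ≤ A * Real.exp (-c * ‖x‖)) {v : Fin p → ℝ} (hv : v ≠ 0) :
    IntegrableOn (fun t : ℝ => g (t • v) * t ^ n) (Ioi 0) := by
  have h := (exp_moment n (b := c * ‖v‖) (by have := norm_pos_iff.2 hv; positivity)).const_mul A
  refine Integrable.mono' h ?_ ?_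
  · exact (Continuous.aestronglyMeasurable (by fun_prop))
  · filter_upwards [ae_restrict_mem measurableSet_Ioi] with t ht
    have ht' : 0 < t := ht
    have h1 := hd (t • v)
    rw [norm_smul, Real.norm_of_nonneg ht'.le] at h1
    rw [Real.norm_of_nonneg (by have := hpos (t • v); positivity), ← mul_assoc]
    gcongr
    have e : -(c * ‖v‖) * t = -c * (t * ‖v‖) := by ring
    rw [e]
    exact h1

lemma den_lower {p : ℕ} (n : ℕ) (g : (Fin p → ℝ) → ℝ) (hg : Continuous g) {m : ℝ}
    {v : Fin p → ℝ} (hm : ∀ t ∈ Ioc (0:ℝ) 1, m ≤ g (t • v)) :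
    m * (1 / (n + 1)) ≤ ∫ t in Ioc (0:ℝ) 1, g (t • v) * t ^ n := by
  have h : ∫ t in Ioc (0:ℝ) 1, m * t ^ n = m * (1 / (n + 1)) := by
    rw [← intervalIntegral.integral_of_le zero_le_one, intervalIntegral.integral_const_mul,
      integral_pow]
    simp
  rw [← h]
  refine setIntegral_mono_on ?_ ?_ measurableSet_Ioc fun t ht => ?_
  · exact (Continuous.integrableOn_Ioc (by fun_prop))
  · exact (Continuous.integrableOn_Ioc (by fun_prop))
  · have := pow_nonneg ht.1.le n
    exact mul_le_mul_of_nonneg_right (hm t ht) this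

open Metric Filter Topology in
lemma ratio_bdd {p : ℕ} (n : ℕ) (g : (Fin p → ℝ) → ℝ) (hpos : ∀ x, 0 < g x)
    (hg : Continuous g) {A c : ℝ} (hA : 0 < A) (hc : 0 < c)
    (hd : ∀ x, g x ≤ A * Real.exp (-c * ‖x‖)) (D : Set (Fin p → ℝ)) (hDk : IsCompact D)
    (hDc : Convex ℝ D) (hD0 : (0 : Fin p → ℝ) ∈ interior D) :
    ∃ B : ℝ, ∀ v ∈ frontier D, (∫ t in Ioi (1:ℝ), g (t • v) * t ^ n) /
      (∫ t in Ioc (0:ℝ) 1, g (t • v) * t ^ n) ≤ B := by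
  have h0 : (0 : Fin p → ℝ) ∈ D := interior_subset hD0
  obtain ⟨x0, hx0, hmin⟩ := hDk.exists_isMinOn ⟨0, h0⟩ hg.continuousOn
  obtain ⟨δ, hδ, hball⟩ := Metric.isOpen_iff.1 isOpen_interior 0 hD0
  refine ⟨(∫ t in Ioi (1:ℝ), A * (Real.exp (-(c * δ) * t) * t ^ n)) / (g x0 * (1 / (n + 1))),
    fun v hv => ?_⟩
  have hvD : v ∈ D := hDk.isClosed.frontier_subset hv
  have hvδ : δ ≤ ‖v‖ := by
    by_contra hcon
    exact hv.2 (hball (by simpa using hcon))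
  have hv0 : v ≠ 0 := norm_pos_iff.1 (hδ.trans_le hvδ)
  have hden := den_lower n g hg (m := g x0) (v := v) fun t ht =>
    hmin (hDc.smul_mem_of_zero_mem h0 hvD ⟨ht.1.le, ht.2⟩)
  have hsub : Ioi (1:ℝ) ⊆ Ioi 0 := Ioi_subset_Ioi zero_le_one
  have hnum : (∫ t in Ioi (1:ℝ), g (t • v) * t ^ n) ≤
      ∫ t in Ioi (1:ℝ), A * (Real.exp (-(c * δ) * t) * t ^ n) := by
    refine setIntegral_mono_on ((ray_integrable n g hpos hg hA hc hd hv0).mono_set hsub)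
      (((exp_moment n (b := c * δ) (by positivity)).mono_set hsub).const_mul A)
      measurableSet_Ioi fun t ht => ?_
    have ht0 : 0 < t := hsub ht
    have h1 := hd (t • v)
    rw [norm_smul, Real.norm_of_nonneg ht0.le] at h1
    rw [← mul_assoc]
    gcongr
    refine h1.trans (mul_le_mul_of_nonneg_left (Real.exp_le_exp.2 ?_) hA.le)
    have : c * t * δ ≤ c * t * ‖v‖ := by gcongr
    linarith
  have := hpos x0
  refine div_le_div₀ ?_ hnum (by positivity) hden
  refine setIntegral_nonneg measurableSet_Ioi fun t ht => ?_
  have ht0 : 0 < t := hsub ht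
  positivity

open Metric Filter Topology in
lemma mass_le {p : ℕ} (hp : 0 < p) (g : (Fin p → ℝ) → ℝ) (hpos : ∀ x, 0 < g x)
    (hg : Continuous g) (hint : Integrable g) {A c : ℝ} (hA : 0 < A) (hc : 0 < c)
    (hd : ∀ x, g x ≤ A * Real.exp (-c * ‖x‖)) (D : Set (Fin p → ℝ)) (hDk : IsCompact D)
    (hDc : Convex ℝ D) (hD0 : (0 : Fin p → ℝ) ∈ interior D) (S : ℝ) (hS : 0 ≤ S)
    (hSv : ∀ v ∈ frontier D, (∫ t in Ioi (1:ℝ), g (t • v) * t ^ (p - 1)) /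
      (∫ t in Ioc (0:ℝ) 1, g (t • v) * t ^ (p - 1)) ≤ S) :
    ∫ x in Dᶜ, g x ≤ S * ∫ x in D, g x := by
  have h0 : (0 : Fin p → ℝ) ∈ D := interior_subset hD0
  have hDn : D ∈ 𝓝 (0 : Fin p → ℝ) := mem_interior_iff_mem_nhds.1 hD0
  have hDm : MeasurableSet D := hDk.isClosed.measurableSet
  have hmem : ∀ x, x ∈ D ↔ gauge D x ≤ 1 := fun x => by
    rw [gauge_le_one_iff_mem_closure hDc hDn, hDk.isClosed.closure_eq]
  have hF : Measurable fun x => ENNReal.ofReal (g x) := hg.measurable.ennreal_ofReal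
  have hnn : ∀ s : Set (Fin p → ℝ), 0 ≤ᵐ[volume.restrict s] g := fun s =>
    Eventually.of_forall fun x => (hpos x).le
  have key : ∫⁻ x in Dᶜ, ENNReal.ofReal (g x) ≤
      ENNReal.ofReal S * ∫⁻ x in D, ENNReal.ofReal (g x) := by
    rw [← lintegral_indicator hDm.compl, ← lintegral_indicator hDm,
      polar_lintegral hp _ (hF.indicator hDm.compl), polar_lintegral hp _ (hF.indicator hDm),
      ← lintegral_const_mul' _ _ ENNReal.ofReal_ne_top]
    refine lintegral_mono fun w => ?_
    have hw1 : ‖(w : Fin p → ℝ)‖ = 1 := by simp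
    have hw0 : (w : Fin p → ℝ) ≠ 0 := by
      intro h; rw [h] at hw1; simp at hw1
    set u : Fin p → ℝ := (w : Fin p → ℝ) with hu
    have hgp : 0 < gauge D u :=
      (gauge_pos (absorbent_nhds_zero hDn)
        ((NormedSpace.isVonNBounded_iff ℝ).2 hDk.isBounded)).2 hw0
    set ρ : ℝ := (gauge D u)⁻¹ with hρ
    have hρp : 0 < ρ := inv_pos.2 hgp
    have hmr : ∀ r : ℝ, 0 < r → (r • u ∈ D ↔ r ≤ ρ) := fun r hr => by
      rw [hmem, gauge_smul_of_nonneg hr.le, smul_eq_mul, hρ, le_inv_comm₀ hr hgp, ← one_div,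
        le_div_iff₀ hr, mul_comm]
    have hfr : ρ • u ∈ frontier D := by
      rw [← gauge_eq_one_iff_mem_frontier hDc hDn, gauge_smul_of_nonneg hρp.le, smul_eq_mul, hρ,
        inv_mul_cancel₀ hgp.ne']
    set h : ℝ → ℝ := fun r => g (r • u) * r ^ (p - 1) with hh
    have hhi : IntegrableOn h (Ioi 0) := ray_integrable (p - 1) g hpos hg hA hc hd hw0
    have hhnn : ∀ s ⊆ Ioi (0:ℝ), MeasurableSet s → 0 ≤ᵐ[volume.restrict s] h := by
      intro s hs hsm
      filter_upwards [ae_restrict_mem hsm] with r hr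
      have hr0 : 0 < r := hs hr
      have := hpos (r • u)
      simp only [hh, Pi.zero_apply]
      positivity
    have hsub1 : Ioi ρ ⊆ Ioi 0 := Ioi_subset_Ioi hρp.le
    have hsub2 : Ioc 0 ρ ⊆ Ioi 0 := fun r hr => hr.1
    -- reduce both radial lintegrals
    have e1 : ∫⁻ r in Ioi (0:ℝ), ENNReal.ofReal (r ^ (p - 1)) *
        (Dᶜ).indicator (fun x => ENNReal.ofReal (g x)) (r • u) = ENNReal.ofReal (∫ r in Ioi ρ, h r) := by
      rw [ofReal_integral_eq_lintegral_ofReal (hhi.mono_set hsub1) (hhnn _ hsub1 measurableSet_Ioi)]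
      have : ∀ r ∈ Ioi (0:ℝ), ENNReal.ofReal (r ^ (p - 1)) *
          (Dᶜ).indicator (fun x => ENNReal.ofReal (g x)) (r • u) =
          (Ioi ρ).indicator (fun r => ENNReal.ofReal (h r)) r := by
        intro r hr
        have hr0 : 0 < r := hr
        by_cases hrr : r ≤ ρ
        · simp [(hmr r hr0).2 hrr, hrr]
        · have hn : r • u ∉ D := fun hx => hrr ((hmr r hr0).1 hx)
          rw [indicator_of_mem hn, indicator_of_mem (show r ∈ Ioi ρ from not_le.1 hrr), 
            ← ENNReal.ofReal_mul (by positivity), mul_comm]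
      rw [setLIntegral_congr_fun measurableSet_Ioi this, setLIntegral_indicator measurableSet_Ioi,
        inter_eq_left.2 hsub1]
    have e2 : ∫⁻ r in Ioi (0:ℝ), ENNReal.ofReal (r ^ (p - 1)) *
        D.indicator (fun x => ENNReal.ofReal (g x)) (r • u) = ENNReal.ofReal (∫ r in Ioc 0 ρ, h r) := by
      rw [ofReal_integral_eq_lintegral_ofReal (hhi.mono_set hsub2) (hhnn _ hsub2 measurableSet_Ioc)]
      have : ∀ r ∈ Ioi (0:ℝ), ENNReal.ofReal (r ^ (p - 1)) *
          D.indicator (fun x => ENNReal.ofReal (g x)) (r • u) =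
          (Ioc 0 ρ).indicator (fun r => ENNReal.ofReal (h r)) r := by
        intro r hr
        have hr0 : 0 < r := hr
        by_cases hrr : r ≤ ρ
        · rw [indicator_of_mem ((hmr r hr0).2 hrr),
            indicator_of_mem (show r ∈ Ioc 0 ρ from ⟨hr0, hrr⟩), 
            ← ENNReal.ofReal_mul (by positivity), mul_comm]
        · have hn : r • u ∉ D := fun hx => hrr ((hmr r hr0).1 hx)
          simp [hn, hrr]
      rw [setLIntegral_congr_fun measurableSet_Ioi this, setLIntegral_indicator measurableSet_Ioc,
        inter_eq_left.2 hsub2]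
    rw [e1, e2, ← ENNReal.ofReal_mul hS]
    apply ENNReal.ofReal_le_ofReal
    -- change of variables
    have hcv : ∀ t : ℝ, g (t • ρ • u) * t ^ (p - 1) = (ρ ^ (p - 1))⁻¹ * h (ρ * t) := fun t => by
      simp only [hh, smul_smul, mul_pow, mul_comm t ρ]
      field_simp
    have hN : ∫ t in Ioi (1:ℝ), g (t • ρ • u) * t ^ (p - 1) =
        (ρ ^ (p - 1))⁻¹ * (ρ⁻¹ * ∫ r in Ioi ρ, h r) := by
      simp_rw [hcv]
      rw [integral_const_mul, integral_comp_mul_left_Ioi h 1 hρp, mul_one, smul_eq_mul]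
    have hDn' : ∫ t in Ioc (0:ℝ) 1, g (t • ρ • u) * t ^ (p - 1) =
        (ρ ^ (p - 1))⁻¹ * (ρ⁻¹ * ∫ r in Ioc 0 ρ, h r) := by
      simp_rw [hcv]
      rw [integral_const_mul, ← intervalIntegral.integral_of_le zero_le_one,
        intervalIntegral.integral_comp_mul_left h hρp.ne', mul_one, mul_zero, smul_eq_mul,
        intervalIntegral.integral_of_le hρp.le]
    obtain ⟨x0, hx0, hmin⟩ := hDk.exists_isMinOn ⟨0, h0⟩ hg.continuousOn
    have hfD : ρ • u ∈ D := hDk.isClosed.frontier_subset hfr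
    have hden := den_lower (p - 1) g hg (m := g x0) (v := ρ • u) fun t ht =>
      hmin (hDc.smul_mem_of_zero_mem h0 hfD ⟨ht.1.le, ht.2⟩)
    have hdp : 0 < ∫ t in Ioc (0:ℝ) 1, g (t • ρ • u) * t ^ (p - 1) := by
      refine lt_of_lt_of_le ?_ hden
      have := hpos x0
      positivity
    have hfin := (div_le_iff₀ hdp).1 (hSv _ hfr)
    rw [hN, hDn'] at hfin
    have hk : 0 < (ρ ^ (p - 1))⁻¹ * ρ⁻¹ := by positivity
    refine le_of_mul_le_mul_left ?_ hk
    linarith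
  rw [← ofReal_integral_eq_lintegral_ofReal hint.integrableOn (hnn _),
    ← ofReal_integral_eq_lintegral_ofReal hint.integrableOn (hnn _),
    ← ENNReal.ofReal_mul hS] at key
  refine (ENNReal.ofReal_le_ofReal_iff ?_).1 key
  exact mul_nonneg hS (integral_nonneg fun x => (hpos x).le)

theorem stmt_12 (p : ℕ) (L : (Fin p → ℝ) → ℝ) (hLpos : ∀ β, 0 < L β)
    (hLlogconc : ConcaveOn ℝ Set.univ (fun β => Real.log (L β)))
    (C : Set (Fin p → ℝ)) (hCcompact : IsCompact C) (hCconvex : Convex ℝ C)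
    (β₀ : Fin p → ℝ) (hβ₀ : β₀ ∈ interior C) :
    (∫ β in Cᶜ, L β) / (∫ β in C, L β)
      ≤ ⨆ v : frontier C,
          (∫ t in Set.Ioi (1 : ℝ), L (β₀ + t • ((v : Fin p → ℝ) - β₀)) * t ^ (p - 1)) /
            (∫ t in Set.Ioc (0 : ℝ) 1,
              L (β₀ + t • ((v : Fin p → ℝ) - β₀)) * t ^ (p - 1)) := by
  have hSnn : 0 ≤ ⨆ v : frontier C,
          (∫ t in Set.Ioi (1 : ℝ), L (β₀ + t • ((v : Fin p → ℝ) - β₀)) * t ^ (p - 1)) /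
            (∫ t in Set.Ioc (0 : ℝ) 1,
              L (β₀ + t • ((v : Fin p → ℝ) - β₀)) * t ^ (p - 1)) := by
    refine Real.iSup_nonneg fun v => div_nonneg ?_ ?_
    · refine setIntegral_nonneg measurableSet_Ioi fun t ht => ?_
      have ht0 : (0:ℝ) < t := zero_lt_one.trans ht
      have := hLpos (β₀ + t • ((v : Fin p → ℝ) - β₀))
      positivity
    · refine setIntegral_nonneg measurableSet_Ioc fun t ht => ?_
      have ht0 : (0:ℝ) < t := ht.1
      have := hLpos (β₀ + t • ((v : Fin p → ℝ) - β₀))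
      positivity
  have hLc : Continuous L := logconc_cont L hLpos hLlogconc
  have hCm : MeasurableSet C := hCcompact.isClosed.measurableSet
  have hCi : IntegrableOn L C := hLc.continuousOn.integrableOn_compact hCcompact
  by_cases hCci : IntegrableOn L Cᶜ
  swap
  · rw [integral_undef hCci, zero_div]
    exact hSnn
  rcases Nat.eq_zero_or_pos p with hp | hp
  · subst hp
    have : C = univ := Subsingleton.eq_univ_of_nonempty ⟨β₀, interior_subset hβ₀⟩
    have h0 : ∫ β in Cᶜ, L β = 0 := by simp [this]
    rw [h0, zero_div]
    exact hSnn
  have hLi : Integrable L := by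
    rw [← integrableOn_univ, ← union_compl_self C]
    exact hCi.union hCci
  set g : (Fin p → ℝ) → ℝ := fun x => L (β₀ + x) with hgdef
  set D : Set (Fin p → ℝ) := (Homeomorph.addLeft β₀) ⁻¹' C with hDdef
  have hgpos : ∀ x, 0 < g x := fun x => hLpos _
  have hgl : ConcaveOn ℝ univ (fun x => Real.log (g x)) := by
    have := hLlogconc.translate_right β₀
    simpa [Function.comp_def] using this
  have hgc : Continuous g := logconc_cont g hgpos hgl
  have hgi : Integrable g := hLi.comp_add_left β₀
  obtain ⟨A, c, hA, hc, hd⟩ := logconc_decay g hgpos hgl hgi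
  have hDk : IsCompact D := (Homeomorph.addLeft β₀).isCompact_preimage.2 hCcompact
  have hDc : Convex ℝ D := hCconvex.translate_preimage_right β₀
  have hD0 : (0 : Fin p → ℝ) ∈ interior D := by
    rw [hDdef, ← Homeomorph.preimage_interior]
    simpa using hβ₀
  have hfr : ∀ v, v ∈ frontier D ↔ β₀ + v ∈ frontier C := fun v => by
    rw [hDdef, ← Homeomorph.preimage_frontier]
    simp
  have hmp : MeasurePreserving (fun x : Fin p → ℝ => β₀ + x) := measurePreserving_add_left _ β₀
  have hme : MeasurableEmbedding (fun x : Fin p → ℝ => β₀ + x) :=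
    (Homeomorph.addLeft β₀).measurableEmbedding
  have i1 : ∫ β in C, L β = ∫ x in D, g x := (hmp.setIntegral_preimage_emb hme L C).symm
  have i2 : ∫ β in Cᶜ, L β = ∫ x in Dᶜ, g x := (hmp.setIntegral_preimage_emb hme L Cᶜ).symm
  obtain ⟨B, hB⟩ := ratio_bdd (p - 1) g hgpos hgc hA hc hd D hDk hDc hD0
  have hfr' : ∀ v : frontier C, (v : Fin p → ℝ) - β₀ ∈ frontier D := fun v => by
    rw [hfr]; simp
  have hbdd : BddAbove (range fun v : frontier C =>
          (∫ t in Set.Ioi (1 : ℝ), L (β₀ + t • ((v : Fin p → ℝ) - β₀)) * t ^ (p - 1)) /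
            (∫ t in Set.Ioc (0 : ℝ) 1,
              L (β₀ + t • ((v : Fin p → ℝ) - β₀)) * t ^ (p - 1))) := by
    refine ⟨B, ?_⟩
    rintro _ ⟨v, rfl⟩
    exact hB _ (hfr' v)
  have hfinal := mass_le hp g hgpos hgc hgi hA hc hd D hDk hDc hD0 _ hSnn fun v hv => by
    have := le_ciSup hbdd ⟨β₀ + v, (hfr v).1 hv⟩
    simpa using this
  rw [i1, i2]
  exact div_le_of_le_mul₀ (integral_nonneg fun x => (hgpos x).le) hSnn hfinal
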